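/- arXiv:1902.02387 — 2 statements merged into one kernel-verified Lean document; each statement's English description precedes it below -/
import Mathlib

section
/- Let 𝓜 and 𝓧 be abelian categories with enough projective and enough injective objects, and let (S, K) be an adjoint pair of functors with S : 𝓜 → 𝓧 left adjoint to K : 𝓧 → 𝓜, where S is exact. Then for every N ∈ 𝓜 and X ∈ 𝓧 there exists an exact sequence of abelian groups 0 → Ext¹_𝓜(N, K(X)) → Ext¹_𝓧(S(N), X) → Hom_𝓜(N, R¹K(X)) → Ext²_𝓜(N, K(X)) → Ext²_𝓧(S(N), X). -/
open CategoryTheory CategoryTheory.Limits CategoryTheory.Abelian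

universe w w' v u v' u'

namespace CategoryTheory

/-- If `A ⟶ B ⟶ E` is exact and `B ⟶ E` factors as `B ⟶ D` followed by a monomorphism, then
`A ⟶ B ⟶ D` is exact. -/
lemma ShortComplex.Exact.of_comp_mono {C : Type u} [Category.{v} C] [Abelian C] {A B D E : C}
    {f : A ⟶ B} {g : B ⟶ E} {w : f ≫ g = 0} (h : (ShortComplex.mk f g w).Exact)
    {p : B ⟶ D} {i : D ⟶ E} [Mono i] (fac : p ≫ i = g) :
    ∃ (w' : f ≫ p = 0), (ShortComplex.mk f p w').Exact := by
  have w' : f ≫ p = 0 := by rw [← cancel_mono i, Category.assoc, fac, w, zero_comp]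
  refine ⟨w', ?_⟩
  let α : ShortComplex.mk f p w' ⟶ ShortComplex.mk f g w :=
    { τ₁ := 𝟙 A
      τ₂ := 𝟙 B
      τ₃ := i }
  have : Epi α.τ₁ := inferInstanceAs (Epi (𝟙 A))
  have : IsIso α.τ₂ := inferInstanceAs (IsIso (𝟙 B))
  have : Mono α.τ₃ := inferInstanceAs (Mono i)
  exact (ShortComplex.exact_iff_of_epi_of_isIso_of_mono α).2 h

/-- If `A ⟶ B ⟶ E` is exact and `A ⟶ B` factors as an epimorphism followed by `D ⟶ B`, then
`D ⟶ B ⟶ E` is exact. -/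
lemma ShortComplex.Exact.of_epi_comp {C : Type u} [Category.{v} C] [Abelian C] {A B D E : C}
    {f : A ⟶ B} {g : B ⟶ E} {w : f ≫ g = 0} (h : (ShortComplex.mk f g w).Exact)
    {p : A ⟶ D} {i : D ⟶ B} [Epi p] (fac : p ≫ i = f) :
    ∃ (w' : i ≫ g = 0), (ShortComplex.mk i g w').Exact := by
  have w' : i ≫ g = 0 := by rw [← cancel_epi p, ← Category.assoc, fac, w, comp_zero]
  refine ⟨w', ?_⟩
  let α : ShortComplex.mk f g w ⟶ ShortComplex.mk i g w' :=
    { τ₁ := p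
      τ₂ := 𝟙 B
      τ₃ := 𝟙 E }
  have : Epi α.τ₁ := inferInstanceAs (Epi p)
  have : IsIso α.τ₂ := inferInstanceAs (IsIso (𝟙 B))
  have : Mono α.τ₃ := inferInstanceAs (Mono (𝟙 E))
  exact (ShortComplex.exact_iff_of_epi_of_isIso_of_mono α).1 h

/-- If `K` is left exact, the homology of `K(A) ⟶ K(B) ⟶ K(C)` is the cokernel of the map from
`K(A)` to the image under `K` of the cycles of `A ⟶ B ⟶ C`. -/
lemma ShortComplex.exists_exact_map_toCycles_homology
    {𝓜 : Type u} [Category.{v} 𝓜] [Abelian 𝓜]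
    {𝓧 : Type u'} [Category.{v'} 𝓧] [Abelian 𝓧]
    (K : 𝓧 ⥤ 𝓜) [K.Additive] [PreservesFiniteLimits K] (T : ShortComplex 𝓧) :
    ∃ (q : K.obj T.cycles ⟶ (T.map K).homology) (w : K.map T.toCycles ≫ q = 0),
      (ShortComplex.mk (K.map T.toCycles) q w).Exact ∧ Epi q := by
  let hK := KernelFork.mapIsLimit _ T.cyclesIsKernel K
  let e : K.obj T.cycles ≅ (T.map K).cycles :=
    hK.conePointUniqueUpToIso (T.map K).cyclesIsKernel
  let t : K.obj T.X₁ ⟶ (T.map K).cycles := (T.map K).toCycles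
  let j : (T.map K).cycles ⟶ K.obj T.X₂ := (T.map K).iCycles
  have : Mono j := inferInstanceAs (Mono (T.map K).iCycles)
  have htj : t ≫ j = K.map T.f := (T.map K).toCycles_i
  have he : e.hom ≫ j = K.map T.iCycles :=
    hK.conePointUniqueUpToIso_hom_comp (T.map K).cyclesIsKernel WalkingParallelPair.zero
  have he' : t ≫ e.inv = K.map T.toCycles := by
    rw [Iso.comp_inv_eq, ← cancel_mono j, Category.assoc, he, ← K.map_comp, htj, T.toCycles_i]
  have ht : t ≫ (T.map K).homologyπ = 0 := (T.map K).toCycles_comp_homologyπ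
  have h : (ShortComplex.mk t (T.map K).homologyπ ht).Exact :=
    ShortComplex.exact_of_g_is_cokernel _ (T.map K).homologyIsCokernel
  refine ⟨e.hom ≫ (T.map K).homologyπ, by rw [← he', Category.assoc, e.inv_hom_id_assoc, ht],
    (ShortComplex.exact_iff_of_iso ?_).1 h, epi_comp _ _⟩
  exact ShortComplex.isoMk (Iso.refl _) e.symm (Iso.refl _)
    ((Category.id_comp _).trans he'.symm) (by simp)

/-- For `K` left exact and `X` in a category with enough injectives, there is a short exact
sequence `0 ⟶ X ⟶ I ⟶ Z ⟶ 0` with `I` injective together with an exact sequence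
`K(I) ⟶ K(Z) ⟶ R¹K(X)`. -/
lemma Functor.exists_shortExact_exact_rightDerived_one
    {𝓜 : Type u} [Category.{v} 𝓜] [Abelian 𝓜]
    {𝓧 : Type u'} [Category.{v'} 𝓧] [Abelian 𝓧] [EnoughInjectives 𝓧]
    (K : 𝓧 ⥤ 𝓜) [K.Additive] [PreservesFiniteLimits K] (X : 𝓧) :
    ∃ (I Z : 𝓧) (f : X ⟶ I) (g : I ⟶ Z) (w : f ≫ g = 0)
      (q : K.obj Z ⟶ (K.rightDerived 1).obj X) (w' : K.map g ≫ q = 0),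
      Injective I ∧ (ShortComplex.mk f g w).ShortExact ∧
        (ShortComplex.mk (K.map g) q w').Exact ∧ Epi q := by
  let R := injectiveResolution X
  let T := ShortComplex.mk _ _ (R.cocomplex.d_comp_d 0 1 2)
  obtain ⟨q, w, hq, hepi⟩ := T.exists_exact_map_toCycles_homology K
  let ρ : (T.map K).homology ≅ (K.rightDerived 1).obj X :=
    (((K.mapHomologicalComplex (ComplexShape.up ℕ)).obj R.cocomplex).homologyIsoSc' 0 1 2
      (by simp) (by simp)).symm ≪≫ (R.isoRightDerivedObj K 1).symm
  let f : X ⟶ T.X₁ := R.ι.f 0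
  have hf₀ : f ≫ T.f = 0 := R.ι_f_zero_comp_complex_d
  have hf₁ : (ShortComplex.mk f T.f hf₀).Exact := R.exact₀
  obtain ⟨hf, hf'⟩ := hf₁.of_comp_mono T.toCycles_i
  refine ⟨T.X₁, T.cycles, f, T.toCycles, hf, q ≫ ρ.hom, by rw [reassoc_of% w, zero_comp],
    R.injective 0, { exact := hf', mono_f := ?_, epi_g := (R.exact_succ 0).epi_toCycles },
    ?_, epi_comp _ _⟩
  · exact inferInstanceAs (Mono (R.ι.f 0))
  · refine (ShortComplex.exact_iff_of_iso ?_).1 hq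
    exact ShortComplex.isoMk (Iso.refl _) (Iso.refl _) ρ

/-- A short exact sequence `0 ⟶ X ⟶ I ⟶ Z ⟶ 0` is mapped by a left exact functor `K` to a short
exact sequence `0 ⟶ K(X) ⟶ K(I) ⟶ B ⟶ 0`, where `B` is the image of `K(I) ⟶ K(Z)`. -/
lemma ShortComplex.ShortExact.exists_shortExact_map
    {𝓜 : Type u} [Category.{v} 𝓜] [Abelian 𝓜]
    {𝓧 : Type u'} [Category.{v'} 𝓧] [Abelian 𝓧]
    {T : ShortComplex 𝓧} (hT : T.ShortExact) (K : 𝓧 ⥤ 𝓜) [K.Additive] [PreservesFiniteLimits K] :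
    ∃ (B : 𝓜) (p : K.obj T.X₂ ⟶ B) (i : B ⟶ K.obj T.X₃) (w : K.map T.f ≫ p = 0),
      (ShortComplex.mk (K.map T.f) p w).ShortExact ∧ Mono i ∧ p ≫ i = K.map T.g := by
  have := hT.mono_f
  have h : (T.map K).Exact := hT.exact.map_of_mono_of_preservesKernel K inferInstance inferInstance
  obtain ⟨w, h'⟩ := ShortComplex.Exact.of_comp_mono h (Abelian.image.fac (K.map T.g))
  have hf : Mono (K.map T.f) := inferInstance
  have hp : Epi (Abelian.factorThruImage (K.map T.g)) := inferInstance
  exact ⟨_, _, _, w, { exact := h', mono_f := hf, epi_g := hp }, inferInstance,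
    Abelian.image.fac _⟩

end CategoryTheory

namespace CategoryTheory.Adjunction

lemma mk₀_homEquiv_symm_comp_extClass_eq_zero_iff
    {𝓜 : Type u} [Category.{v} 𝓜] {𝓧 : Type u'} [Category.{v'} 𝓧] [Abelian 𝓧] [HasExt.{w'} 𝓧]
    {S : 𝓜 ⥤ 𝓧} {K : 𝓧 ⥤ 𝓜} (adj : S ⊣ K) {T : ShortComplex 𝓧} (hT : T.ShortExact) {N : 𝓜}
    (c : N ⟶ K.obj T.X₃) :
    (Ext.mk₀ ((adj.homEquiv N T.X₃).symm c)).comp hT.extClass (zero_add 1) = 0 ↔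
      ∃ a : N ⟶ K.obj T.X₂, a ≫ K.map T.g = c := by
  constructor
  · intro h
    obtain ⟨a, ha⟩ := Ext.covariant_sequence_exact₃ _ hT _ _ h
    obtain ⟨a, rfl⟩ := (Ext.mk₀_bijective _ _).2 a
    rw [Ext.mk₀_comp_mk₀] at ha
    refine ⟨adj.homEquiv N T.X₂ a, ?_⟩
    rw [← adj.homEquiv_naturality_right, (Ext.mk₀_bijective _ _).1 ha, Equiv.apply_symm_apply]
  · rintro ⟨a, rfl⟩
    rw [adj.homEquiv_naturality_right_symm, ← Ext.mk₀_comp_mk₀,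
      Ext.comp_assoc_of_second_deg_zero, hT.comp_extClass, Ext.comp_zero]

variable {𝓜 : Type u} [Category.{v} 𝓜] [Abelian 𝓜] [HasExt.{w} 𝓜]
  {𝓧 : Type u'} [Category.{v'} 𝓧] [Abelian 𝓧] [HasExt.{w'} 𝓧]
  {S : 𝓜 ⥤ 𝓧} {K : 𝓧 ⥤ 𝓜} (adj : S ⊣ K) [S.Additive]
  [PreservesFiniteLimits S] [PreservesFiniteColimits S]

/-- The comparison map `Ext^n(N, K Y) → Ext^n(S N, Y)` attached to an adjunction `S ⊣ K` with `S`
exact. -/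
noncomputable def extMap (N : 𝓜) (Y : 𝓧) (n : ℕ) : Ext N (K.obj Y) n →+ Ext (S.obj N) Y n :=
  ((Ext.mk₀ (adj.counit.app Y)).postcomp (S.obj N) (add_zero n)).comp
    (S.mapExtAddHom N (K.obj Y) n)

lemma extMap_apply {N : 𝓜} {Y : 𝓧} {n : ℕ} (e : Ext N (K.obj Y) n) :
    adj.extMap N Y n e =
      (e.mapExactFunctor S).comp (Ext.mk₀ (adj.counit.app Y)) (add_zero n) := rfl

lemma extMap_mk₀ {N : 𝓜} {Y : 𝓧} (a : N ⟶ K.obj Y) :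
    adj.extMap N Y 0 (Ext.mk₀ a) = Ext.mk₀ ((adj.homEquiv N Y).symm a) := by
  simp [extMap_apply, Ext.mapExactFunctor_mk₀, homEquiv_counit]

/-- The comparison maps are compatible with the connecting maps of `0 ⟶ X ⟶ I ⟶ Z ⟶ 0` and
`0 ⟶ K(X) ⟶ K(I) ⟶ B ⟶ 0`, where `K(I) ⟶ K(Z)` factors through `B`. -/
lemma extMap_comp_extClass {T : ShortComplex 𝓧} (hT : T.ShortExact) {B : 𝓜}
    {p : K.obj T.X₂ ⟶ B} {w : K.map T.f ≫ p = 0} (hB : (ShortComplex.mk (K.map T.f) p w).ShortExact)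
    {i : B ⟶ K.obj T.X₃} (fac : p ≫ i = K.map T.g)
    {N : 𝓜} {n m : ℕ} (y : Ext N B n) (h : n + 1 = m) :
    adj.extMap N T.X₁ m (y.comp hB.extClass h) =
      (adj.extMap N T.X₃ n (y.comp (Ext.mk₀ i) (add_zero n))).comp hT.extClass h := by
  let α : (ShortComplex.mk (K.map T.f) p w).map S ⟶ T :=
    { τ₁ := adj.counit.app T.X₁
      τ₂ := adj.counit.app T.X₂
      τ₃ := S.map i ≫ adj.counit.app T.X₃
      comm₁₂ := (adj.counit.naturality T.f).symm
      comm₂₃ := by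
        change adj.counit.app T.X₂ ≫ T.g = S.map p ≫ S.map i ≫ adj.counit.app T.X₃
        rw [← S.map_comp_assoc, fac]
        exact (adj.counit.naturality T.g).symm }
  have hα := ShortComplex.ShortExact.extClass_naturality (hB.map_of_exact S) hT α
  simp only [extMap_apply, Ext.mapExactFunctor_comp, Ext.mapExactFunctor_mk₀,
    Ext.mapExactFunctor_extClass]
  refine (Ext.comp_assoc_of_third_deg_zero _ _ _ _).trans
    ((congrArg (fun z => (y.mapExactFunctor S).comp z h) hα).trans ?_)
  rw [Ext.comp_assoc_of_third_deg_zero, Ext.mk₀_comp_mk₀]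
  exact (Ext.comp_assoc_of_second_deg_zero _ _ _ _).symm

lemma extMap_one_injective [K.Additive] [EnoughInjectives 𝓧] (N : 𝓜) (X : 𝓧) :
    Function.Injective (adj.extMap N X 1) := by
  have := adj.rightAdjoint_preservesLimits
  let P := (EnoughInjectives.presentation X).some
  have hT := P.shortExact_shortComplex
  obtain ⟨B, p, i, w, hB, _, fac⟩ := hT.exists_shortExact_map K
  have : Injective (K.obj P.shortComplex.X₂) :=
    have : Injective P.shortComplex.X₂ := P.injective
    Injective.injective_of_adjoint adj _
  rw [injective_iff_map_eq_zero]
  intro e he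
  obtain ⟨y, rfl⟩ := Ext.covariant_sequence_exact₁ _ hB e (Ext.eq_zero_of_injective _) (zero_add 1)
  obtain ⟨b, rfl⟩ := (Ext.mk₀_bijective _ _).2 y
  have he' := (adj.extMap_comp_extClass hT hB fac (Ext.mk₀ b) (zero_add 1)).symm.trans he
  rw [Ext.mk₀_comp_mk₀, extMap_mk₀, mk₀_homEquiv_symm_comp_extClass_eq_zero_iff] at he'
  obtain ⟨a, ha⟩ := he'
  obtain rfl : a ≫ p = b := by rw [← cancel_mono i, Category.assoc, fac, ha]
  rw [← Ext.mk₀_comp_mk₀, Ext.comp_assoc_of_second_deg_zero]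
  exact (congrArg (fun z => (Ext.mk₀ a).comp z (zero_add 1)) hB.comp_extClass).trans
    (Ext.comp_zero _ _ _ _ _)

end CategoryTheory.Adjunction

theorem five_term_exact_sequence_of_adjunction_right
    {𝓜 : Type u} [Category.{v} 𝓜] [Abelian 𝓜]
    [EnoughProjectives 𝓜] [EnoughInjectives 𝓜] [HasExt.{w} 𝓜]
    {𝓧 : Type u'} [Category.{v'} 𝓧] [Abelian 𝓧]
    [EnoughProjectives 𝓧] [EnoughInjectives 𝓧] [HasExt.{w'} 𝓧]
    (S : 𝓜 ⥤ 𝓧) (K : 𝓧 ⥤ 𝓜) (adj : S ⊣ K) [K.Additive]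
    [PreservesFiniteLimits S] [PreservesFiniteColimits S]
    (N : 𝓜) (X : 𝓧) :
    ∃ (f₁ : Ext N (K.obj X) 1 →+ Ext (S.obj N) X 1)
      (f₂ : Ext (S.obj N) X 1 →+ ((N ⟶ (K.rightDerived 1).obj X)))
      (f₃ : ((N ⟶ (K.rightDerived 1).obj X)) →+ Ext N (K.obj X) 2)
      (f₄ : Ext N (K.obj X) 2 →+ Ext (S.obj N) X 2),
      Function.Injective f₁ ∧
      Function.Exact f₁ f₂ ∧
      Function.Exact f₂ f₃ ∧
      Function.Exact f₃ f₄ := by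
  have : S.Additive := adj.left_adjoint_additive
  have := adj.rightAdjoint_preservesLimits
  obtain ⟨I, Z, f, g, w, q, w', _, hT, hq, _⟩ := K.exists_shortExact_exact_rightDerived_one X
  obtain ⟨B, p, i, wp, hB, _, fac⟩ := hT.exists_shortExact_map K
  dsimp only at p i wp hB fac
  have : Epi p := hB.epi_g
  have : Injective (K.obj I) := Injective.injective_of_adjoint adj _
  obtain ⟨wi, hq'⟩ := hq.of_epi_comp fac
  have hE : (ShortComplex.mk i q wi).ShortExact := { exact := hq' }
  let π : (N ⟶ K.obj Z) →+ Ext (S.obj N) X 1 :=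
    (hT.extClass.postcomp (S.obj N) (zero_add 1)).comp
      ((adj.extMap N Z 0).comp (Ext.addEquiv₀ (X := N) (Y := K.obj Z)).symm.toAddMonoidHom)
  have π_apply (c : N ⟶ K.obj Z) :
      π c = (Ext.mk₀ ((adj.homEquiv N Z).symm c)).comp hT.extClass (zero_add 1) :=
    congrArg (fun z => z.comp hT.extClass (zero_add 1)) (adj.extMap_mk₀ c)
  have π_eq_zero_iff (c : N ⟶ K.obj Z) : π c = 0 ↔ ∃ a : N ⟶ K.obj I, a ≫ K.map g = c := by
    rw [π_apply]
    exact adj.mk₀_homEquiv_symm_comp_extClass_eq_zero_iff hT c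
  have π_surjective : Function.Surjective π := fun e => by
    obtain ⟨c, rfl⟩ :=
      Ext.covariant_sequence_exact₁ _ hT e (Ext.eq_zero_of_injective _) (zero_add 1)
    obtain ⟨c, rfl⟩ := (Ext.mk₀_bijective _ _).2 c
    exact ⟨adj.homEquiv N Z c, by rw [π_apply, Equiv.symm_apply_apply]⟩
  obtain ⟨f₂, hf₂⟩ : ∃ f₂ : Ext (S.obj N) X 1 →+ (N ⟶ (K.rightDerived 1).obj X),
      ∀ c, f₂ (π c) = c ≫ q := by
    have hker : π.ker ≤ (Preadditive.rightComp N q).ker := fun c hc => by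
      obtain ⟨a, rfl⟩ := (π_eq_zero_iff c).1 hc
      change (a ≫ K.map g) ≫ q = 0
      rw [Category.assoc, w', comp_zero]
    exact ⟨π.liftOfRightInverse _ (Function.rightInverse_surjInv π_surjective) ⟨_, hker⟩,
      fun c => π.liftOfRightInverse_comp_apply _ _ ⟨_, hker⟩ c⟩
  let δ : Ext N B 1 →+ Ext N (K.obj X) 2 := hB.extClass.postcomp N rfl
  let f₃ : (N ⟶ (K.rightDerived 1).obj X) →+ Ext N (K.obj X) 2 :=
    (δ.comp (hE.extClass.postcomp N (zero_add 1))).comp Ext.addEquiv₀.symm.toAddMonoidHom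
  have f₃_apply (r : N ⟶ (K.rightDerived 1).obj X) :
      f₃ r = ((Ext.mk₀ r).comp hE.extClass (zero_add 1)).comp hB.extClass rfl := rfl
  have f₁_apply (b : N ⟶ B) :
      adj.extMap N X 1 ((Ext.mk₀ b).comp hB.extClass (zero_add 1)) = π (b ≫ i) := by
    refine (adj.extMap_comp_extClass hT hB fac (Ext.mk₀ b) (zero_add 1)).trans ?_
    rw [Ext.mk₀_comp_mk₀, adj.extMap_mk₀, π_apply]
  have δ_injective (y : Ext N B 1) (hy : y.comp hB.extClass rfl = 0) : y = 0 := by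
    obtain ⟨z, rfl⟩ := Ext.covariant_sequence_exact₃ _ hB y rfl hy
    have : z = 0 := Ext.eq_zero_of_injective (I := K.obj I) z
    rw [this, Ext.zero_comp]
  refine ⟨adj.extMap N X 1, f₂, f₃, adj.extMap N X 2, adj.extMap_one_injective N X, ?_, ?_, ?_⟩
  · intro e
    obtain ⟨c, rfl⟩ := π_surjective e
    rw [hf₂]
    constructor
    · intro h
      refine ⟨(Ext.mk₀ (hE.exact.lift c h)).comp hB.extClass (zero_add 1), ?_⟩
      rw [f₁_apply]
      exact congrArg π (hE.exact.lift_f c h)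
    · rintro ⟨y, hy⟩
      obtain ⟨y, rfl⟩ :=
        Ext.covariant_sequence_exact₁ _ hB y (Ext.eq_zero_of_injective (I := K.obj I) _) (zero_add 1)
      obtain ⟨b, rfl⟩ := (Ext.mk₀_bijective _ _).2 y
      have h : (b ≫ i) ≫ q = c ≫ q := by
        rw [← hf₂, ← hf₂, ← hy]
        exact congrArg f₂ (f₁_apply b).symm
      rw [← h, Category.assoc, wi, comp_zero]
  · intro r
    rw [f₃_apply]
    constructor
    · intro h
      obtain ⟨c, hc⟩ := Ext.covariant_sequence_exact₃ _ hE (Ext.mk₀ r) (zero_add 1) (δ_injective _ h)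
      obtain ⟨c, rfl⟩ := (Ext.mk₀_bijective _ _).2 c
      rw [Ext.mk₀_comp_mk₀] at hc
      exact ⟨π c, by rw [hf₂]; exact (Ext.mk₀_bijective _ _).1 hc⟩
    · rintro ⟨e, rfl⟩
      obtain ⟨c, rfl⟩ := π_surjective e
      rw [hf₂, ← Ext.mk₀_comp_mk₀, Ext.comp_assoc_of_second_deg_zero]
      have h : (Ext.mk₀ q).comp hE.extClass (zero_add 1) = 0 := hE.comp_extClass
      rw [h, Ext.comp_zero, Ext.zero_comp]
  · intro e
    constructor
    · intro he
      obtain ⟨y, rfl⟩ :=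
        Ext.covariant_sequence_exact₁ _ hB e (Ext.eq_zero_of_injective (I := K.obj I) _) rfl
      have h := (adj.extMap_comp_extClass hT hB fac y rfl).symm.trans he
      obtain ⟨z, hz⟩ := Ext.covariant_sequence_exact₃ _ hT _ _ h
      have hz₀ : z = 0 := Ext.eq_zero_of_injective (I := I) z
      rw [hz₀, Ext.zero_comp] at hz
      have hy := (injective_iff_map_eq_zero _).1 (adj.extMap_one_injective N Z) _ hz.symm
      obtain ⟨r, rfl⟩ := Ext.covariant_sequence_exact₁ _ hE y hy (zero_add 1)
      obtain ⟨r, rfl⟩ := (Ext.mk₀_bijective _ _).2 r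
      exact ⟨r, rfl⟩
    · rintro ⟨r, rfl⟩
      rw [f₃_apply]
      refine (adj.extMap_comp_extClass hT hB fac _ rfl).trans ?_
      have h : hE.extClass.comp (Ext.mk₀ i) (add_zero 1) = 0 := hE.extClass_comp
      rw [Ext.comp_assoc_of_third_deg_zero, h, Ext.comp_zero, map_zero, Ext.zero_comp]
end

section
/- In the abstract setup, let (𝓐, 𝓑) be a hereditary cotorsion pair in 𝓜, and assume that L₂C_j(X) = 0 for every j ∈ J and every X ∈ 𝓔_L. Then (Φ(𝓐), Φ(𝓐)^⊥) is a hereditary cotorsion pair in 𝓧; in particular Φ(𝓐) is closed under kernels of epimorphisms and Φ(𝓐)^⊥ is closed under cokernels of monomorphisms. -/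
/-!
Statement 6 (Theorem 1.11(i)): if `(𝓐, 𝓑)` is a hereditary cotorsion pair in `𝓜` and `L₂C_j` vanishes on `𝓔_L`, then `(Φ(𝓐), Φ(𝓐)^⊥)` is a hereditary cotorsion pair in `𝓧`.
(Holm–Jørgensen, "Model categories of quiver representations".)
-/

open CategoryTheory CategoryTheory.Limits CategoryTheory.Abelian

universe w w' v u v' u'

section Defs

variable {𝓨 : Type u} [Category.{v} 𝓨] [Abelian 𝓨] [HasExt.{w} 𝓨]

/-- `Γ^⊥ = {Y | Ext¹(C, Y) = 0 for all C ∈ Γ}`. -/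
def rightPerp (Γ : Set 𝓨) : Set 𝓨 :=
  {Y | ∀ C ∈ Γ, Subsingleton (Ext C Y 1)}

/-- `⊥Δ = {Y | Ext¹(Y, D) = 0 for all D ∈ Δ}`. -/
def leftPerp (Δ : Set 𝓨) : Set 𝓨 :=
  {Y | ∀ D ∈ Δ, Subsingleton (Ext Y D 1)}

/-- `(Γ, Δ)` is a cotorsion pair if `Γ = ⊥Δ` and `Γ^⊥ = Δ`. -/
def IsCotorsionPair (Γ Δ : Set 𝓨) : Prop :=
  Γ = leftPerp Δ ∧ rightPerp Γ = Δ

/-- `Γ` is closed under kernels of epimorphisms. -/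
def ClosedUnderKernelsOfEpis (Γ : Set 𝓨) : Prop :=
  ∀ ⦃X Y : 𝓨⦄ (f : X ⟶ Y), Epi f → X ∈ Γ → Y ∈ Γ → (kernel f : 𝓨) ∈ Γ

/-- `Δ` is closed under cokernels of monomorphisms. -/
def ClosedUnderCokernelsOfMonos (Δ : Set 𝓨) : Prop :=
  ∀ ⦃X Y : 𝓨⦄ (f : X ⟶ Y), Mono f → X ∈ Δ → Y ∈ Δ → (cokernel f : 𝓨) ∈ Δ

/-- A cotorsion pair `(Γ, Δ)` is hereditary if `Γ` is closed under kernels of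
epimorphisms and `Δ` is closed under cokernels of monomorphisms. -/
def IsHereditary (Γ Δ : Set 𝓨) : Prop :=
  ClosedUnderKernelsOfEpis Γ ∧ ClosedUnderCokernelsOfMonos Δ

end Defs

section Setup

variable {𝓜 : Type u} [Category.{v} 𝓜] [Abelian 𝓜]
  [EnoughProjectives 𝓜] [EnoughInjectives 𝓜] [HasExt.{w} 𝓜]
variable {𝓧 : Type u'} [Category.{v'} 𝓧] [Abelian 𝓧]
  [EnoughProjectives 𝓧] [EnoughInjectives 𝓧] [HasExt.{w'} 𝓧]
variable {J : Type*} (Cf Kf : J → (𝓧 ⥤ 𝓜)) (Sf : J → (𝓜 ⥤ 𝓧))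

/-- `Φ(𝓒) = {X | ∀ j, C_j(X) ∈ 𝓒 and L₁C_j(X) = 0}`. -/
def Phi [∀ j, (Cf j).Additive] (𝓒 : Set 𝓜) : Set 𝓧 :=
  {X | ∀ j, (Cf j).obj X ∈ 𝓒 ∧ IsZero (((Cf j).leftDerived 1).obj X)}

/-- `Ψ(𝓒) = {X | ∀ j, K_j(X) ∈ 𝓒 and R¹K_j(X) = 0}`. -/
def Psi [∀ j, (Kf j).Additive] (𝓒 : Set 𝓜) : Set 𝓧 :=
  {X | ∀ j, (Kf j).obj X ∈ 𝓒 ∧ IsZero (((Kf j).rightDerived 1).obj X)}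

/-- `𝓔_L = {X | ∀ j, L₁C_j(X) = 0}`. -/
def EL [∀ j, (Cf j).Additive] : Set 𝓧 :=
  {X | ∀ j, IsZero (((Cf j).leftDerived 1).obj X)}

/-- `𝓔_R = {X | ∀ j, R¹K_j(X) = 0}`. -/
def ER [∀ j, (Kf j).Additive] : Set 𝓧 :=
  {X | ∀ j, IsZero (((Kf j).rightDerived 1).obj X)}

end Setup

section ExtVanishing

variable {C : Type u} [Category.{v} C] [Abelian C]

/-- In an abelian category with enough injectives, exactness in the middle can be tested
by maps into injective objects. -/
lemma exact_iff_forall_injective [EnoughInjectives C] (S : ShortComplex C) :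
    S.Exact ↔ ∀ (I : C) [Injective I] (f : S.X₂ ⟶ I), S.f ≫ f = 0 →
      ∃ g : S.X₃ ⟶ I, S.g ≫ g = f := by
  refine ⟨fun hS I _ f hf ↦ ⟨hS.descToInjective f hf, hS.comp_descToInjective f hf⟩, fun H ↦ ?_⟩
  rw [ShortComplex.exact_iff_mono_cokernel_desc]
  obtain ⟨g, hg⟩ := H (Injective.under (cokernel S.f)) (cokernel.π S.f ≫ Injective.ι _)
    (by simp)
  have : cokernel.desc S.f S.g S.zero ≫ g = Injective.ι _ := by
    rw [← cancel_epi (cokernel.π S.f), cokernel.π_desc_assoc, hg]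
  exact mono_of_mono_fac this

variable [HasExt.{w} C]

/-- `Ext` groups in positive degrees vanish iff the functor `Hom(-, Y)` is exact at the
corresponding place of a projective resolution. -/
lemma subsingleton_ext_iff_of_projectiveResolution {X Y : C} (R : ProjectiveResolution X)
    (n : ℕ) :
    Subsingleton (Ext X Y (n + 1)) ↔
      ∀ f : R.complex.X (n + 1) ⟶ Y, R.complex.d (n + 2) (n + 1) ≫ f = 0 →
        ∃ g : R.complex.X n ⟶ Y, R.complex.d (n + 1) n ≫ g = f := by
  refine ⟨fun _ f hf ↦ ?_, fun H ↦ subsingleton_of_forall_eq 0 fun α ↦ ?_⟩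
  · exact (R.extMk_eq_zero_iff f (n + 2) rfl hf n rfl).1 (Subsingleton.elim _ _)
  · obtain ⟨f, hf, rfl⟩ := R.extMk_surjective α (n + 2) rfl
    exact (R.extMk_eq_zero_iff f (n + 2) rfl hf n rfl).2 (H f hf)

variable {S : ShortComplex C}

/-- If the middle term of `0 ⟶ X₁ ⟶ X₂ ⟶ X₃ ⟶ 0` is projective, then `Ext¹(X₃, Y) = 0` iff
every morphism `X₁ ⟶ Y` extends to `X₂`. -/
lemma subsingleton_ext_one_iff_of_projective (hS : S.ShortExact) [Projective S.X₂] (Y : C) :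
    Subsingleton (Ext S.X₃ Y 1) ↔ ∀ f : S.X₁ ⟶ Y, ∃ g : S.X₂ ⟶ Y, S.f ≫ g = f := by
  refine ⟨fun _ f ↦ ?_, fun H ↦ subsingleton_of_forall_eq 0 fun α ↦ ?_⟩
  · obtain ⟨x, hx⟩ := Ext.contravariant_sequence_exact₁ hS Y (Ext.mk₀ f) (add_zero 1)
      (Subsingleton.elim _ _)
    obtain ⟨g, rfl⟩ := Ext.addEquiv₀.symm.surjective x
    refine ⟨g, Ext.addEquiv₀.symm.injective ?_⟩
    simpa using hx
  · obtain ⟨x, rfl⟩ := Ext.contravariant_sequence_exact₃ hS Y α (Ext.eq_zero_of_projective _)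
      (add_zero 1)
    obtain ⟨f, rfl⟩ := Ext.addEquiv₀.symm.surjective x
    obtain ⟨g, rfl⟩ := H f
    simp [← Ext.mk₀_comp_mk₀]

lemma subsingleton_ext_from_X₁ (hS : S.ShortExact) (Y : C) (n : ℕ)
    (h₂ : Subsingleton (Ext S.X₂ Y n)) (h₃ : Subsingleton (Ext S.X₃ Y (n + 1))) :
    Subsingleton (Ext S.X₁ Y n) := by
  refine subsingleton_of_forall_eq 0 fun α ↦ ?_
  obtain ⟨x, rfl⟩ := Ext.contravariant_sequence_exact₁ hS Y α (add_comm 1 n)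
    (Subsingleton.elim _ _)
  rw [Subsingleton.elim x 0, Ext.comp_zero]

lemma subsingleton_ext_from_X₃ (hS : S.ShortExact) (Y : C) (n : ℕ)
    (h₁ : Subsingleton (Ext S.X₁ Y n)) (h₂ : Subsingleton (Ext S.X₂ Y (n + 1))) :
    Subsingleton (Ext S.X₃ Y (n + 1)) := by
  refine subsingleton_of_forall_eq 0 fun α ↦ ?_
  obtain ⟨x, rfl⟩ := Ext.contravariant_sequence_exact₃ hS Y α
    (Subsingleton.elim _ _) (add_comm 1 n)
  rw [Subsingleton.elim x 0, Ext.comp_zero]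

lemma subsingleton_ext_to_X₁ (hS : S.ShortExact) (X : C) (n : ℕ)
    (h₂ : Subsingleton (Ext X S.X₂ (n + 1))) (h₃ : Subsingleton (Ext X S.X₃ n)) :
    Subsingleton (Ext X S.X₁ (n + 1)) := by
  refine subsingleton_of_forall_eq 0 fun α ↦ ?_
  obtain ⟨x, rfl⟩ := Ext.covariant_sequence_exact₁ X hS α (Subsingleton.elim _ _) rfl
  rw [Subsingleton.elim x 0, Ext.zero_comp]

lemma subsingleton_ext_to_X₃ (hS : S.ShortExact) (X : C) (n : ℕ)
    (h₁ : Subsingleton (Ext X S.X₁ (n + 1))) (h₂ : Subsingleton (Ext X S.X₂ n)) :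
    Subsingleton (Ext X S.X₃ n) := by
  refine subsingleton_of_forall_eq 0 fun α ↦ ?_
  obtain ⟨x, rfl⟩ := Ext.covariant_sequence_exact₃ X hS α rfl (Subsingleton.elim _ _)
  rw [Subsingleton.elim x 0, Ext.zero_comp]

end ExtVanishing

section KernelSequences

variable {C : Type u} [Category.{v} C] [Abelian C]

lemma shortExact_kernel_of_epi {X Y : C} (f : X ⟶ Y) [Epi f] :
    (ShortComplex.mk (kernel.ι f) f (kernel.condition f)).ShortExact where
  exact := ShortComplex.exact_kernel f
  mono_f := inferInstanceAs (Mono (kernel.ι f))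
  epi_g := ‹Epi f›

lemma shortExact_cokernel_of_mono {X Y : C} (f : X ⟶ Y) [Mono f] :
    (ShortComplex.mk f (cokernel.π f) (cokernel.condition f)).ShortExact where
  exact := ShortComplex.exact_cokernel f
  mono_f := ‹Mono f›
  epi_g := inferInstanceAs (Epi (cokernel.π f))

end KernelSequences

section CotorsionPairs

variable {C : Type u} [Category.{v} C] [Abelian C] [HasExt.{w} C]

lemma isCotorsionPair_leftPerp (T : Set C) :
    IsCotorsionPair (leftPerp T) (rightPerp (leftPerp T)) :=
  ⟨Set.Subset.antisymm (fun _ hX _ hD ↦ hD _ hX)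
    (fun _ hX D hD ↦ hX D fun _ hC ↦ hC D hD), rfl⟩

/-- A left orthogonal class that is closed under kernels of epimorphisms has a right
orthogonal class that is closed under cokernels of monomorphisms. -/
lemma closedUnderCokernelsOfMonos_rightPerp_leftPerp [EnoughProjectives C] {T : Set C}
    (hT : ClosedUnderKernelsOfEpis (leftPerp T)) :
    ClosedUnderCokernelsOfMonos (rightPerp (leftPerp T)) := by
  intro Y Y' f hf hY hY' X hX
  have hP : Projective.over X ∈ leftPerp T := fun _ _ ↦ Ext.subsingleton_of_projective _ _ 0
  refine subsingleton_ext_to_X₃ (shortExact_cokernel_of_mono f) X 1 ?_ (hY' X hX)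
  exact subsingleton_ext_from_X₃ (shortExact_kernel_of_epi (Projective.π X)) Y 1
    (hY _ (hT _ inferInstance hP hX)) (Ext.subsingleton_of_projective _ _ 1)

end CotorsionPairs

section Adjunction

/-- A morphism `F A ⟶ Y` extends along `F p` iff its transpose extends along `p`. -/
lemma CategoryTheory.Adjunction.exists_map_comp_eq_iff
    {𝓜 : Type u} [Category.{v} 𝓜] {𝓧 : Type u'} [Category.{v'} 𝓧] {F : 𝓧 ⥤ 𝓜} {G : 𝓜 ⥤ 𝓧}
    (adj : F ⊣ G) {A B : 𝓧} (p : A ⟶ B) (Y : 𝓜) (f : F.obj A ⟶ Y) :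
    (∃ g : F.obj B ⟶ Y, F.map p ≫ g = f) ↔
      ∃ g : B ⟶ G.obj Y, p ≫ g = adj.homEquiv _ _ f := by
  refine (adj.homEquiv B Y).exists_congr fun g ↦ ?_
  rw [← adj.homEquiv_naturality_left, EmbeddingLike.apply_eq_iff_eq]

variable {𝓜 : Type u} [Category.{v} 𝓜] [Abelian 𝓜]
variable {𝓧 : Type u'} [Category.{v'} 𝓧] [Abelian 𝓧]
variable {F : 𝓧 ⥤ 𝓜} {G : 𝓜 ⥤ 𝓧}
  [F.Additive] [EnoughProjectives 𝓧] [EnoughInjectives 𝓜]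

/-- The left derived functors of a left adjoint `F ⊣ G` vanish on `X` iff `X` has no extensions
by the images under `G` of injective objects. -/
lemma isZero_leftDerived_obj_iff [HasExt.{w'} 𝓧] (adj : F ⊣ G) (X : 𝓧) (n : ℕ) :
    IsZero ((F.leftDerived (n + 1)).obj X) ↔
      ∀ (I : 𝓜) [Injective I], Subsingleton (Ext X (G.obj I) (n + 1)) := by
  let R := projectiveResolution X
  have := adj.right_adjoint_additive
  rw [(R.isoLeftDerivedObj F (n + 1)).isZero_iff, HomologicalComplex.homologyFunctor_obj,
    ← HomologicalComplex.exactAt_iff_isZero_homology,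
    HomologicalComplex.exactAt_iff' _ (n + 2) (n + 1) n (by simp) (by simp),
    exact_iff_forall_injective]
  refine forall_congr' fun I ↦ forall_congr' fun _ ↦ ?_
  rw [subsingleton_ext_iff_of_projectiveResolution R]
  refine (adj.homEquiv (R.complex.X (n + 1)) I).forall_congr fun {f} ↦ ?_
  refine imp_congr ?_ (adj.exists_map_comp_eq_iff _ _ _)
  change F.map _ ≫ f = 0 ↔ _
  rw [← adj.homEquiv_naturality_left, ← (adj.homAddEquiv _ _).map_eq_zero_iff]
  rfl

/-- If `L₁F` vanishes on `X`, then `Ext¹(F X, B)` vanishes iff `Ext¹(X, G B)` does. -/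
lemma subsingleton_ext_one_obj_iff [HasExt.{w} 𝓜] [HasExt.{w'} 𝓧] [G.PreservesEpimorphisms]
    (adj : F ⊣ G) {X : 𝓧} (hX : IsZero ((F.leftDerived 1).obj X)) (B : 𝓜) :
    Subsingleton (Ext (F.obj X) B 1) ↔ Subsingleton (Ext X (G.obj B) 1) := by
  have hS := shortExact_kernel_of_epi (Projective.π X)
  set S := ShortComplex.mk (kernel.ι (Projective.π X)) _ (kernel.condition _)
  have : Projective S.X₂ := inferInstanceAs (Projective (Projective.over X))
  have : Projective (S.map F).X₂ := adj.map_projective _ this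
  have := adj.isLeftAdjoint
  have hext (I : 𝓜) [Injective I] :
      ∀ f : F.obj S.X₁ ⟶ I, ∃ g : F.obj S.X₂ ⟶ I, F.map S.f ≫ g = f := fun f ↦
    (adj.exists_map_comp_eq_iff _ _ _).2 <|
      (subsingleton_ext_one_iff_of_projective hS _).1
        ((isZero_leftDerived_obj_iff adj X 0).1 hX I) _
  have hFS : (S.map F).ShortExact := by
    have := hS.epi_g
    obtain ⟨g, hg⟩ := hext (Injective.under (F.obj S.X₁)) (Injective.ι _)
    have hmono : Mono (F.map S.f) := mono_of_mono_fac hg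
    exact { exact := hS.exact.map_of_epi_of_preservesCokernel F inferInstance inferInstance
            mono_f := hmono
            epi_g := inferInstanceAs (Epi (F.map S.g)) }
  rw [subsingleton_ext_one_iff_of_projective hS (G.obj B)]
  refine (subsingleton_ext_one_iff_of_projective hFS B).trans ?_
  exact (adj.homEquiv S.X₁ B).forall_congr fun {f} ↦ adj.exists_map_comp_eq_iff _ _ _

end Adjunction

section PhiClass

variable {𝓜 : Type u} [Category.{v} 𝓜] [Abelian 𝓜] [EnoughInjectives 𝓜] [HasExt.{w} 𝓜]
variable {𝓧 : Type u'} [Category.{v'} 𝓧] [Abelian 𝓧] [EnoughProjectives 𝓧] [HasExt.{w'} 𝓧]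
variable {J : Type*} {Cf : J → (𝓧 ⥤ 𝓜)} {Sf : J → (𝓜 ⥤ 𝓧)} [∀ j, (Cf j).Additive]

/-- `Φ(⊥𝓑)` is the left orthogonal of the class of all `S_j(B)` with `B ∈ 𝓑`. -/
lemma Phi_leftPerp_eq [∀ j, (Sf j).PreservesEpimorphisms] (adj : ∀ j, Cf j ⊣ Sf j)
    {𝓑 : Set 𝓜} (h𝓑 : ∀ (I : 𝓜) [Injective I], I ∈ 𝓑) :
    Phi Cf (leftPerp 𝓑) = leftPerp {Y | ∃ j, ∃ B ∈ 𝓑, (Sf j).obj B = Y} := by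
  ext X
  constructor
  · rintro hX _ ⟨j, B, hB, rfl⟩
    exact (subsingleton_ext_one_obj_iff (adj j) (hX j).2 B).1 ((hX j).1 B hB)
  · intro hX j
    have h1 : IsZero (((Cf j).leftDerived 1).obj X) :=
      (isZero_leftDerived_obj_iff (adj j) X 0).2 fun I _ ↦ hX _ ⟨j, I, h𝓑 I, rfl⟩
    exact ⟨fun B hB ↦ (subsingleton_ext_one_obj_iff (adj j) h1 B).2 (hX _ ⟨j, B, hB, rfl⟩), h1⟩

end PhiClass

theorem phi_hereditary_cotorsionPair
    {𝓜 : Type u} [Category.{v} 𝓜] [Abelian 𝓜]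
    [EnoughProjectives 𝓜] [EnoughInjectives 𝓜] [HasExt.{w} 𝓜]
    {𝓧 : Type u'} [Category.{v'} 𝓧] [Abelian 𝓧]
    [EnoughProjectives 𝓧] [EnoughInjectives 𝓧] [HasExt.{w'} 𝓧]
    {J : Type*} (Cf Kf : J → (𝓧 ⥤ 𝓜)) (Sf : J → (𝓜 ⥤ 𝓧))
    [∀ j, (Cf j).Additive] [∀ j, (Kf j).Additive]
    (adjCS : ∀ j, Cf j ⊣ Sf j) (adjSK : ∀ j, Sf j ⊣ Kf j)
    (𝓐 𝓑 : Set 𝓜) (h : IsCotorsionPair 𝓐 𝓑) (hher : IsHereditary 𝓐 𝓑)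
    (hL2 : ∀ (j : J), ∀ X ∈ EL Cf, IsZero (((Cf j).leftDerived 2).obj X)) :
    IsCotorsionPair (Phi Cf 𝓐) (rightPerp (Phi Cf 𝓐)) ∧
    IsHereditary (Phi Cf 𝓐) (rightPerp (Phi Cf 𝓐)) := by
  obtain ⟨rfl, h𝓑⟩ := h
  have hinj (I : 𝓜) [Injective I] : I ∈ 𝓑 :=
    h𝓑 ▸ fun _ _ ↦ subsingleton_of_forall_eq 0 Ext.eq_zero_of_injective
  have (j : J) : (Sf j).Additive := (adjCS j).right_adjoint_additive
  have (j : J) : (Sf j).IsLeftAdjoint := (adjSK j).isLeftAdjoint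
  have (j : J) : (Sf j).IsRightAdjoint := (adjCS j).isRightAdjoint
  have hEq := Phi_leftPerp_eq adjCS hinj
  have hker : ClosedUnderKernelsOfEpis (Phi Cf (leftPerp 𝓑)) := by
    intro X Y f _ hX hY
    rw [hEq] at hX ⊢
    rintro _ ⟨j, B, hB, rfl⟩
    refine subsingleton_ext_from_X₁ (shortExact_kernel_of_epi f) _ 1
      (hX _ ⟨j, B, hB, rfl⟩) ?_
    refine subsingleton_ext_to_X₁
      ((shortExact_cokernel_of_mono (Injective.ι B)).map_of_exact (Sf j)) Y 1 ?_ ?_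
    · exact (isZero_leftDerived_obj_iff (adjCS j) Y 1).1 (hL2 j Y fun i ↦ (hY i).2) _
    · rw [hEq] at hY
      exact hY _ ⟨j, _, hher.2 _ inferInstance hB (hinj _), rfl⟩
  rw [hEq] at hker ⊢
  exact ⟨isCotorsionPair_leftPerp _, hker,
    closedUnderCokernelsOfMonos_rightPerp_leftPerp hker⟩
end
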